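/- arXiv:math/9810128 — 8 statements merged into one kernel-verified Lean document; each statement's English description precedes it below -/
import Mathlib

section
/- For a continuum Y the following are equivalent: (1) Y is a 2-to-1 retract of a continuum; (2) there is a simple continuous map from some continuum into Y that admits a 1-to-1 cover and whose image is Y; (3) there is a continuous map from some continuum into Y that admits a 1-to-1 cover and whose image is Y. -/
open Set Metric Topology

/-- A subcontinuum of a topological space: a nonempty compact connected subset. -/
def IsSubcontinuum {X : Type*} [TopologicalSpace X] (K : Set X) : Prop :=
  IsCompact K ∧ IsConnected K

/-- The metric space `Y` is an `m`-to-1 retract of a continuum: there is a continuum `X`,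
a subcontinuum `Y'` of `X` homeomorphic to `Y`, and a continuous retraction of `X` onto `Y'`
under which every point of `Y'` has exactly `m` preimages. -/
def IsMToOneRetract (m : ℕ) (Y : Type*) [MetricSpace Y] : Prop :=
  ∃ (X : Type) (_ : MetricSpace X), CompactSpace X ∧ ConnectedSpace X ∧ Nonempty X ∧
    ∃ Y' : Set X, IsSubcontinuum Y' ∧ Nonempty (Y ≃ₜ Y') ∧
      ∃ r : X → X, Continuous r ∧ (∀ x, r x ∈ Y') ∧ (∀ y ∈ Y', r y = y) ∧
        ∀ y ∈ Y', {x : X | r x = y}.ncard = m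

/-- A 1-to-1 cover of a map `f` : a restriction of `f` to an open proper subset `U`
of the domain such that `f` is injective on `U` and `f(U) = f(X)`. -/
def HasOneToOneCover {X Y : Type*} [TopologicalSpace X] (f : X → Y) : Prop :=
  ∃ U : Set X, IsOpen U ∧ U ≠ Set.univ ∧ Set.InjOn f U ∧ f '' U = Set.range f

/-- Strictly locally 1-to-1: locally injective but not injective. -/
def StrictlyLocallyInjective {X Y : Type*} [TopologicalSpace X] (f : X → Y) : Prop :=
  (∀ x : X, ∃ U ∈ 𝓝 x, Set.InjOn f U) ∧ ¬ Function.Injective f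

/-- A map is simple if each point-inverse of a point of the image has cardinality one or two. -/
def SimpleMap {X Y : Type*} (f : X → Y) : Prop :=
  ∀ y ∈ Set.range f, (f ⁻¹' {y}).ncard = 1 ∨ (f ⁻¹' {y}).ncard = 2

/-- `f` is injective on each proper subcontinuum of its domain. -/
def InjOnProperSubcontinua {X Y : Type*} [TopologicalSpace X] (f : X → Y) : Prop :=
  ∀ K : Set X, IsSubcontinuum K → K ≠ Set.univ → Set.InjOn f K

/-- Two sets are separated if neither contains a limit point of the other. -/
def SeparatedSets {X : Type*} [TopologicalSpace X] (A B : Set X) : Prop :=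
  Disjoint (closure A) B ∧ Disjoint A (closure B)

/-- Every subcontinuum with more than one point is the union of two proper subcontinua. -/
def HereditarilyDecomposable (X : Type*) [TopologicalSpace X] : Prop :=
  ∀ K : Set X, IsSubcontinuum K → K.Nontrivial →
    ∃ A B : Set X, IsSubcontinuum A ∧ IsSubcontinuum B ∧
      A ⊆ K ∧ B ⊆ K ∧ A ≠ K ∧ B ≠ K ∧ A ∪ B = K

/-- Arclike: for each `ε > 0` there is an `ε`-map onto `[0,1]`. -/
def Arclike (X : Type*) [MetricSpace X] : Prop :=
  ∀ ε > (0:ℝ), ∃ g : X → ℝ, Continuous g ∧ Set.range g = Set.Icc 0 1 ∧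
    ∀ t : ℝ, Metric.diam (g ⁻¹' {t}) < ε

/-- A tree: a connected finite graph (a continuum that is a finite union of arcs meeting
only at endpoints) containing no simple closed curve. -/
def IsTree (T : Type*) [MetricSpace T] : Prop :=
  CompactSpace T ∧ ConnectedSpace T ∧ Nonempty T ∧
    (∃ (n : ℕ) (γ : Fin n → ℝ → T),
      (∀ i, ContinuousOn (γ i) (Set.Icc 0 1) ∧ Set.InjOn (γ i) (Set.Icc 0 1)) ∧
      (⋃ i, γ i '' Set.Icc 0 1) = Set.univ ∧
      (∀ i j, i ≠ j →
        (γ i '' Set.Icc 0 1) ∩ (γ j '' Set.Icc 0 1) ⊆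
          ({γ i 0, γ i 1, γ j 0, γ j 1} : Set T))) ∧
    ¬ ∃ S : Set T, Nonempty (S ≃ₜ (Metric.sphere (0:ℂ) 1))

/-- Treelike: for each `ε > 0` there is an `ε`-map onto a tree. -/
def Treelike (X : Type*) [MetricSpace X] : Prop :=
  ∀ ε > (0:ℝ), ∃ (T : Type) (_ : MetricSpace T), IsTree T ∧
    ∃ g : X → T, Continuous g ∧ Function.Surjective g ∧
      ∀ t : T, Metric.diam (g ⁻¹' {t}) < ε
/-- The complement of the image of a 2-to-1 retraction is a 1-to-1 cover of that retraction. -/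
theorem IsMToOneRetract.exists_simpleMap_hasOneToOneCover {Y : Type} [MetricSpace Y]
    (h : IsMToOneRetract 2 Y) :
    ∃ (X : Type) (_ : MetricSpace X), CompactSpace X ∧ ConnectedSpace X ∧ Nonempty X ∧
      ∃ f : X → Y, Continuous f ∧ Function.Surjective f ∧ SimpleMap f ∧
        HasOneToOneCover f := by
  obtain ⟨X, _, hc, hconn, hne, Y', ⟨hY'c, hY'conn⟩, ⟨e⟩, r, hr, hrY, hid, hcard⟩ := h
  have hf : ∀ x y, e.symm ⟨r x, hrY x⟩ = y ↔ r x = e y := fun x y => by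
    rw [e.symm_apply_eq, Subtype.ext_iff]
  have hsurj : Function.Surjective fun x => e.symm ⟨r x, hrY x⟩ := fun y =>
    ⟨e y, (hf _ _).2 (hid _ (e y).2)⟩
  refine ⟨X, inferInstance, hc, hconn, hne, fun x => e.symm ⟨r x, hrY x⟩,
    e.symm.continuous.comp (hr.subtype_mk hrY), hsurj, fun y _ => Or.inr ?_,
    Y'ᶜ, hY'c.isClosed.isOpen_compl, ?_, ?_, ?_⟩
  · rw [← hcard (e y) (e y).2]
    congr 1
    ext x
    exact hf x y
  · obtain ⟨y, hy⟩ := hY'conn.nonempty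
    exact fun h => (h ▸ mem_univ y : y ∈ Y'ᶜ) hy
  · intro a ha b hb hab
    have hab' : r a = r b := by simpa using hab
    obtain ⟨p, q, -, hpq⟩ := ncard_eq_two.1 (hcard (r a) (hrY a))
    have h1 : a ∈ {x | r x = r a} := rfl
    have h2 : b ∈ {x | r x = r a} := hab'.symm
    have h3 : r a ∈ {x | r x = r a} := hid _ (hrY a)
    have h4 : a ≠ r a := fun h => ha (h ▸ hrY a)
    have h5 : b ≠ r a := fun h => hb (h ▸ hrY a)
    rw [hpq] at h1 h2 h3
    grind
  · rw [hsurj.range_eq, eq_univ_iff_forall]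
    intro y
    obtain ⟨b, hb, hby⟩ := exists_ne_of_one_lt_ncard
      (by rw [hcard (e y) (e y).2]; norm_num) (e y : X)
    refine ⟨b, fun hbY => hby ?_, (hf b y).2 hb⟩
    rw [← hid b hbY]
    exact hb

/-- If `U` is a 1-to-1 cover of `f : X → Y`, then gluing `X` to `Y` along `f` on the complement of
`U` yields a continuum that retracts 2-to-1 onto `Y`. The glued space is realized in `Y × ℝ` by
means of `x ↦ (f x, infDist x Uᶜ)`. -/
theorem HasOneToOneCover.isMToOneRetract_two {X Y : Type} [MetricSpace X] [CompactSpace X]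
    [ConnectedSpace X] [MetricSpace Y] [CompactSpace Y] [ConnectedSpace Y] {f : X → Y}
    (hf : Continuous f) (hsurj : Function.Surjective f) (h : HasOneToOneCover f) :
    IsMToOneRetract 2 Y := by
  obtain ⟨U, hU, hUne, hinj, himg⟩ := h
  rw [hsurj.range_eq] at himg
  have hKne : (Uᶜ).Nonempty := nonempty_compl.2 hUne
  have hpos : ∀ x ∈ U, 0 < infDist x Uᶜ := fun x hx =>
    (hU.isClosed_compl.notMem_iff_infDist_pos hKne).1 (not_not.2 hx)
  have hzero : ∀ x ∉ U, infDist x Uᶜ = 0 := fun x hx => infDist_zero_of_mem hx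
  let g : X → Y × ℝ := fun x => (f x, infDist x Uᶜ)
  let i : Y → Y × ℝ := fun y => (y, 0)
  have hg : Continuous g := hf.prodMk (continuous_infDist_pt _)
  have hi : Continuous i := by fun_prop
  let Z : Set (Y × ℝ) := range g ∪ range i
  have hZc : IsCompact Z := (isCompact_range hg).union (isCompact_range hi)
  have hZconn : IsConnected Z := by
    obtain ⟨k, hk⟩ := hKne
    refine (isConnected_range hg).union ⟨g k, mem_range_self k, f k, ?_⟩ (isConnected_range hi)
    simp [g, i, hzero k hk]
  have hiZ : ∀ y, i y ∈ Z := fun y => Or.inr ⟨y, rfl⟩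
  let j : Y → Z := fun y => ⟨i y, hiZ y⟩
  have hj : Continuous j := hi.subtype_mk hiZ
  have hjinj : Function.Injective j := fun a b hab =>
    congrArg (fun z : Z => z.1.1) hab
  refine ⟨Z, inferInstance, isCompact_iff_compactSpace.1 hZc,
    isConnected_iff_connectedSpace.1 hZconn, hZconn.nonempty.to_subtype, range j,
    ⟨isCompact_range hj, isConnected_range hj⟩,
    ⟨(hj.isClosedEmbedding hjinj).isEmbedding.toHomeomorph⟩, fun z => j z.1.1,
    by fun_prop, fun z => mem_range_self _, ?_, ?_⟩
  · rintro _ ⟨y, rfl⟩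
    rfl
  · rintro _ ⟨y, rfl⟩
    obtain ⟨u, hu, rfl⟩ : y ∈ f '' U := himg ▸ mem_univ y
    refine ncard_eq_two.2 ⟨j (f u), ⟨g u, Or.inl ⟨u, rfl⟩⟩, fun h => ?_, ?_⟩
    · exact (hpos u hu).ne (congrArg (fun z : Z => z.1.2) h)
    · ext ⟨z, hz⟩
      simp only [mem_ofPred_eq, mem_insert_iff, mem_singleton_iff, hjinj.eq_iff]
      constructor
      · intro hzu
        rcases hz with ⟨x, rfl⟩ | ⟨y, rfl⟩
        · by_cases hx : x ∈ U
          · right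
            obtain rfl := hinj hx hu hzu
            rfl
          · left
            exact Subtype.ext (Prod.ext hzu (hzero x hx))
        · left
          exact Subtype.ext (Prod.ext hzu rfl)
      · rintro (h | h)
        · exact congrArg (fun z : Z => z.1.1) h
        · exact congrArg (fun z : Z => z.1.1) h

/-- The following are equivalent for the continuum `Y`:
(1) `Y` is a 2-to-1 retract of a continuum;
(2) there is a simple map with a 1-to-1 cover from a continuum onto `Y`;
(3) there is a map with a 1-to-1 cover from a continuum onto `Y`. -/
theorem two_to_one_retract_iff_one_to_one_cover
    (Y : Type) [MetricSpace Y] [CompactSpace Y] [ConnectedSpace Y] [Nonempty Y] :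
    (IsMToOneRetract 2 Y ↔
      (∃ (X : Type) (_ : MetricSpace X), CompactSpace X ∧ ConnectedSpace X ∧ Nonempty X ∧
        ∃ f : X → Y, Continuous f ∧ Function.Surjective f ∧ SimpleMap f ∧
          HasOneToOneCover f)) ∧
    (IsMToOneRetract 2 Y ↔
      (∃ (X : Type) (_ : MetricSpace X), CompactSpace X ∧ ConnectedSpace X ∧ Nonempty X ∧
        ∃ f : X → Y, Continuous f ∧ Function.Surjective f ∧ HasOneToOneCover f)) := by
  refine ⟨⟨fun h => h.exists_simpleMap_hasOneToOneCover, ?_⟩, ⟨fun h => ?_, ?_⟩⟩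
  · rintro ⟨X, _, _, _, _, f, hf, hsurj, -, h⟩
    exact h.isMToOneRetract_two hf hsurj
  · obtain ⟨X, m, hc, hconn, hne, f, hf, hsurj, -, hcov⟩ := h.exists_simpleMap_hasOneToOneCover
    exact ⟨X, m, hc, hconn, hne, f, hf, hsurj, hcov⟩
  · rintro ⟨X, _, _, _, _, f, hf, hsurj, h⟩
    exact h.isMToOneRetract_two hf hsurj
end

section
/- Suppose X is a continuum, D and E are disjoint subcontinua of X, and h is a continuous map from D into E. Then the quotient space Y obtained from X by identifying each point x of D with h(x) (i.e., the quotient of X by the equivalence relation whose nontrivial classes are the sets {h⁻¹(e)} ∪ {e} for e in the image of h) is a 2-to-1 retract of a continuum. -/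
open Set Metric Topology

/-- If `X` is a continuum, `D` and `E` are disjoint subcontinua of `X`, `h` maps `D`
continuously into `E`, and `Y` is the quotient of `X` identifying each `x ∈ D` with `h x`
(realized by a continuous surjection `q` onto the metric space `Y` with exactly those fibers),
then `Y` is a 2-to-1 retract of a continuum. -/
theorem quotient_by_map_between_disjoint_subcontinua_is_two_to_one_retract
    (X Y : Type) [MetricSpace X] [CompactSpace X] [ConnectedSpace X] [Nonempty X]
    [MetricSpace Y]
    (D E : Set X) (hD : IsSubcontinuum D) (hE : IsSubcontinuum E) (hDE : Disjoint D E)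
    (h : X → X) (hc : ContinuousOn h D) (hmap : Set.MapsTo h D E)
    (q : X → Y) (hq : Continuous q) (hqs : Function.Surjective q)
    (hfib : ∀ x y : X, q x = q y ↔
      (x = y ∨ (x ∈ D ∧ y = h x) ∨ (y ∈ D ∧ x = h y) ∨ (x ∈ D ∧ y ∈ D ∧ h x = h y))) :
    IsMToOneRetract 2 Y := by
  have : CompactSpace Y := hqs.compactSpace hq
  have : ConnectedSpace Y := hqs.connectedSpace hq
  have hDcl : IsClosed D := hD.1.isClosed
  have hDne : D.Nonempty := hD.2.nonempty
  have hpos : ∀ x, x ∉ D → 0 < infDist x D := fun x hx =>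
    (hDcl.notMem_iff_infDist_pos hDne).1 hx
  have hrep : ∀ y, ∃ x, x ∉ D ∧ q x = y := by
    intro y
    obtain ⟨x, rfl⟩ := hqs y
    by_cases hx : x ∈ D
    · refine ⟨h x, fun hh => Set.disjoint_left.1 hDE hh (hmap hx), ?_⟩
      exact ((hfib x (h x)).2 (Or.inr (Or.inl ⟨hx, rfl⟩))).symm
    · exact ⟨x, hx, rfl⟩
  have huniq : ∀ x x', x ∉ D → x' ∉ D → q x = q x' → x = x' := by
    intro x x' hx hx' he
    have := (hfib x x').1 he
    tauto
  let i : Y → Y × ℝ := fun y => (y, 0)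
  let j : X → Y × ℝ := fun x => (q x, infDist x D)
  have hi : Continuous i := by fun_prop
  have hj : Continuous j := hq.prodMk (continuous_infDist_pt D)
  let Z : Set (Y × ℝ) := range i ∪ range j
  have hZc : IsCompact Z := (isCompact_range hi).union (isCompact_range hj)
  have hZconn : IsConnected Z := by
    refine (isConnected_range hi).union ?_ (isConnected_range hj)
    obtain ⟨d, hd⟩ := hDne
    exact ⟨(q d, 0), ⟨q d, rfl⟩, d, by simp [j, infDist_zero_of_mem hd]⟩
  let i' : Y → Z := fun y => ⟨i y, Or.inl ⟨y, rfl⟩⟩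
  have hi' : Continuous i' := hi.subtype_mk _
  have hinj : Function.Injective i' := fun a b hab =>
    congrArg (fun z : Z => z.1.1) hab
  refine ⟨Z, inferInstance, isCompact_iff_compactSpace.1 hZc,
    isConnected_iff_connectedSpace.1 hZconn, hZconn.nonempty.to_subtype, range i',
    ⟨isCompact_range hi', isConnected_range hi'⟩,
    ⟨(hi'.isClosedEmbedding hinj).isEmbedding.toHomeomorph⟩,
    fun z => i' z.1.1, hi'.comp (continuous_fst.comp continuous_subtype_val),
    fun z => ⟨_, rfl⟩, ?_, ?_⟩
  · rintro _ ⟨y, rfl⟩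
    rfl
  · rintro _ ⟨y, rfl⟩
    obtain ⟨x, hx, rfl⟩ := hrep y
    rw [Set.ncard_eq_two]
    refine ⟨i' (q x), ⟨j x, Or.inr ⟨x, rfl⟩⟩, ?_, ?_⟩
    · intro he
      exact (hpos x hx).ne (congrArg (fun z : Z => z.1.2) he)
    · ext z
      simp only [mem_ofPred_eq, mem_insert_iff, mem_singleton_iff, hinj.eq_iff]
      constructor
      · obtain ⟨_, ⟨y, rfl⟩ | ⟨x', rfl⟩⟩ := z
        · rintro (rfl : y = q x)
          exact Or.inl rfl
        · intro (he : q x' = q x)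
          by_cases hx' : x' ∈ D
          · left
            apply Subtype.ext
            change (q x', infDist x' D) = (q x, 0)
            rw [he, infDist_zero_of_mem hx']
          · right
            simp only [huniq x' x hx' hx he]
      · rintro (rfl | rfl) <;> rfl
end

section
/- Suppose X is a continuum and p and q are two distinct points of X. Then the quotient space X/{p,q} obtained by identifying p with q is a 2-to-1 retract of a continuum. -/
open Set Metric Topology

/-- If `X` is a continuum and `p ≠ q` are points of `X`, then the quotient `X/{p,q}`
(realized by a continuous surjection `g` onto the metric space `Y` whose only nontrivial
fiber is `{p, q}`) is a 2-to-1 retract of a continuum. -/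
theorem quotient_identifying_two_points_is_two_to_one_retract
    (X Y : Type) [MetricSpace X] [CompactSpace X] [ConnectedSpace X] [Nonempty X]
    [MetricSpace Y] (p q : X) (hpq : p ≠ q)
    (g : X → Y) (hg : Continuous g) (hgs : Function.Surjective g)
    (hfib : ∀ x y : X, g x = g y ↔
      (x = y ∨ (x ∈ ({p, q} : Set X) ∧ y ∈ ({p, q} : Set X)))) :
    IsMToOneRetract 2 Y := by
  have : CompactSpace Y := hgs.compactSpace hg
  have : ConnectedSpace Y := hgs.connectedSpace hg
  have hgpq : g q = g p := (hfib q p).2 (Or.inr ⟨by simp, by simp⟩)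
  have hfy : Continuous fun y : Y => (y, p) := by fun_prop
  have hfx : Continuous fun x : X => (g x, x) := by fun_prop
  let Z : Set (Y × X) := range (fun y : Y => (y, p)) ∪ range (fun x : X => (g x, x))
  have hZcompact : IsCompact Z := (isCompact_range hfy).union (isCompact_range hfx)
  have hZconn : IsConnected Z :=
    IsConnected.union ⟨(g p, p), ⟨g p, rfl⟩, ⟨p, rfl⟩⟩
      (isConnected_range hfy) (isConnected_range hfx)
  have : CompactSpace Z := isCompact_iff_compactSpace.1 hZcompact
  have : ConnectedSpace Z := isConnected_iff_connectedSpace.1 hZconn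
  let i : Y → Z := fun y => ⟨(y, p), Or.inl ⟨y, rfl⟩⟩
  let j : X → Z := fun x => ⟨(g x, x), Or.inr ⟨x, rfl⟩⟩
  have hi : Continuous i := hfy.subtype_mk _
  have hinj : Function.Injective i := fun a b h => congrArg (fun z : Z => z.1.1) h
  have hemb : IsClosedEmbedding i := hi.isClosedEmbedding hinj
  refine ⟨Z, inferInstance, inferInstance, inferInstance, inferInstance, range i,
    ⟨isCompact_range hi, isConnected_range hi⟩, ⟨hemb.isEmbedding.toHomeomorph⟩,
    fun z => i z.1.1, by fun_prop, fun z => mem_range_self _, ?_, ?_⟩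
  · rintro _ ⟨y, rfl⟩
    rfl
  rintro _ ⟨y, rfl⟩
  obtain ⟨x, hxp, rfl⟩ : ∃ x, x ≠ p ∧ g x = y := by
    obtain ⟨x, rfl⟩ := hgs y
    by_cases hx : x = p
    · exact ⟨q, hpq.symm, by rw [hgpq, hx]⟩
    · exact ⟨x, hx, rfl⟩
  have hij : i (g x) ≠ j x := fun h => hxp (congrArg (fun z : Z => z.1.2) h).symm
  rw [← ncard_pair hij]
  congr 1
  ext z
  simp only [mem_ofPred_eq, mem_insert_iff, mem_singleton_iff, hinj.eq_iff]
  constructor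
  · intro hz
    obtain ⟨_, ⟨y, rfl⟩ | ⟨w, rfl⟩⟩ := z
    · exact Or.inl (Subtype.ext (Prod.ext hz rfl))
    · have hw : g w = g x := hz
      by_cases hwp : w = p
      · exact Or.inl (Subtype.ext (Prod.ext hw hwp))
      · have hwx : w = x := by
          rcases (hfib w x).1 hw with h | ⟨h₁, h₂⟩
          · exact h
          · exact (h₁.resolve_left hwp).trans (h₂.resolve_left hxp).symm
        exact Or.inr (Subtype.ext (Prod.ext hw hwx))
  · rintro (rfl | rfl) <;> rfl
end

section
/- Suppose Y is a continuum and K is a subcontinuum of Y such that Y \ K is connected, and there is an open set U containing K such that U \ K is the union of two nonempty separated sets A and B, and K contains both a limit point of A and a limit point of B. Then Y is a 2-to-1 retract of a continuum. -/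
open Set Metric Topology

/-- A space `Y` is a 2-to-1 retract as soon as it carries a positive function `g` for which the
union of the zero section and the graph of `g` is compact and connected. -/
theorem isMToOneRetract_two_of_graph {Y : Type} [MetricSpace Y] [CompactSpace Y]
    [ConnectedSpace Y] (g : Y → ℝ) (hg : ∀ y, 0 < g y)
    (hcomp : IsCompact {p : Y × ℝ | p.2 = 0 ∨ p.2 = g p.1})
    (hconn : IsConnected {p : Y × ℝ | p.2 = 0 ∨ p.2 = g p.1}) :
    IsMToOneRetract 2 Y := by
  set S : Set (Y × ℝ) := {p | p.2 = 0 ∨ p.2 = g p.1} with hS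
  have : ConnectedSpace S := isConnected_iff_connectedSpace.mp hconn
  let s : Y → S := fun y => ⟨(y, 0), Or.inl rfl⟩
  have hs : Continuous s := by fun_prop
  have hinj : Function.Injective s := fun a b h => congrArg (fun x : S => x.1.1) h
  refine ⟨S, inferInstance, isCompact_iff_compactSpace.mp hcomp, inferInstance, inferInstance,
    range s, ⟨isCompact_range hs, isConnected_range hs⟩,
    ⟨(hs.isClosedEmbedding hinj).isEmbedding.toHomeomorph⟩, fun x => s x.1.1, by fun_prop,
    fun x => mem_range_self _, ?_, ?_⟩
  · rintro _ ⟨y, rfl⟩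
    rfl
  · rintro _ ⟨y, rfl⟩
    have hset : {x : S | s x.1.1 = s y} = {s y, ⟨(y, g y), Or.inr rfl⟩} := by
      ext ⟨⟨z, t⟩, hz⟩
      simp only [mem_ofPred_eq, hinj.eq_iff, mem_insert_iff, mem_singleton_iff, s,
        Subtype.mk.injEq, Prod.mk.injEq, ← and_or_left]
      constructor
      · rintro rfl
        exact ⟨rfl, hz⟩
      · exact And.left
    rw [hset, ncard_pair]
    intro h
    exact (hg y).ne (congrArg (fun x : S => x.1.2) h)

/-- If `K` is a local cut continuum of the continuum `Y` that is not a cut continuum, i.e.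
`Y \ K` is connected but there is an open set `U ⊇ K` with `U \ K = A ∪ B`, two nonempty
separated sets, and `K` contains a limit point of `A` and a limit point of `B`, then `Y`
is a 2-to-1 retract of a continuum. -/
theorem local_cut_continuum_implies_two_to_one_retract
    (Y : Type) [MetricSpace Y] [CompactSpace Y] [ConnectedSpace Y] [Nonempty Y]
    (K : Set Y) (hK : IsSubcontinuum K) (hconn : IsConnected Kᶜ)
    (U : Set Y) (hU : IsOpen U) (hKU : K ⊆ U)
    (A B : Set Y) (hAB : U \ K = A ∪ B) (hA : A.Nonempty) (hB : B.Nonempty)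
    (hsep : SeparatedSets A B)
    (hlimA : ∃ a ∈ K, a ∈ closure A) (hlimB : ∃ b ∈ K, b ∈ closure B) :
    IsMToOneRetract 2 Y := by
  classical
  have hKc : IsClosed K := hK.1.isClosed
  have hAo : IsOpen A := by
    have : A = (U \ K) \ closure B := by
      rw [hAB]
      ext x
      constructor
      · exact fun hx => ⟨Or.inl hx, fun h => hsep.2.le_bot ⟨hx, h⟩⟩
      · rintro ⟨hx | hx, h⟩
        · exact hx
        · exact absurd (subset_closure hx) h
    rw [this]
    exact (hU.sdiff hKc).sdiff isClosed_closure
  have hAK : ∀ x ∈ A, x ∉ K := fun x hx => (hAB.symm.subset (Or.inl hx)).2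
  have hBK : ∀ x ∈ B, x ∉ K := fun x hx => (hAB.symm.subset (Or.inr hx)).2
  have hBA : ∀ x ∈ B, x ∉ A := fun x hx h => hsep.2.le_bot ⟨h, subset_closure hx⟩
  obtain ⟨φ, hφ0, hφ1, hφ⟩ := exists_continuous_zero_one_of_isClosed hU.isClosed_compl hKc
    (disjoint_left.mpr fun x hx hxK => hx (hKU hxK))
  let d : Y → ℝ := fun y => infDist y K
  have hd : Continuous d := continuous_infDist_pt K
  have hd0 : ∀ y ∈ K, d y = 0 := fun y hy => infDist_zero_of_mem hy
  have hdpos : ∀ y ∉ K, 0 < d y := fun y hy => (hKc.notMem_iff_infDist_pos hK.2.nonempty).mp hy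
  have hφA : ∀ x ∈ closure A, x ∉ A → x ∉ K → φ x = 0 := fun x hx hxA hxK => hφ0 fun hxU => by
    rcases hAB.subset ⟨hxU, hxK⟩ with h | h
    · exact hxA h
    · exact hsep.1.le_bot ⟨hx, h⟩
  let g : Y → ℝ := (A ∪ K).piecewise (fun y => d y + φ y) d
  have hgA : ∀ y ∈ A, g y = d y + φ y := fun y hy => piecewise_eq_of_mem _ _ _ (Or.inl hy)
  have hgK : ∀ y ∈ K, g y = 1 := fun y hy => by
    have : g y = d y + φ y := piecewise_eq_of_mem _ _ _ (Or.inr hy)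
    rw [this, hd0 y hy, hφ1 hy]
    simp
  have hgd : ∀ y, y ∉ A → y ∉ K → g y = d y := fun y h h' =>
    piecewise_eq_of_notMem _ _ _ (not_or.mpr ⟨h, h'⟩)
  have hgpos : ∀ y, 0 < g y := fun y => by
    by_cases hyK : y ∈ K
    · rw [hgK y hyK]
      exact one_pos
    · by_cases hyA : y ∈ A
      · rw [hgA y hyA]
        exact add_pos_of_pos_of_nonneg (hdpos y hyK) (hφ y).1
      · rw [hgd y hyA hyK]
        exact hdpos y hyK
  have hgcont : ContinuousOn g Kᶜ := by
    refine ContinuousOn.piecewise ?_ (by fun_prop) hd.continuousOn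
    rintro x ⟨hxK, hx⟩
    rw [frontier, closure_union, hKc.closure_eq] at hx
    have hxA : x ∉ A := fun h => hx.2 (interior_maximal subset_union_left hAo h)
    simp [hφA x (hx.1.resolve_right hxK) hxA hxK]
  have hcomp : IsCompact {p : Y × ℝ | p.2 = 0 ∨ p.2 = g p.1} := by
    have : {p : Y × ℝ | p.2 = 0 ∨ p.2 = g p.1} = range (fun y : Y => (y, (0 : ℝ))) ∪
        ((fun y => (y, d y)) '' Aᶜ ∪ (fun y => (y, d y + φ y)) '' (closure A ∪ K)) := by
      ext ⟨y, t⟩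
      simp only [mem_ofPred_eq, mem_union, mem_range, mem_image, Prod.mk.injEq]
      constructor
      · rintro (rfl | rfl)
        · exact Or.inl ⟨y, rfl, rfl⟩
        · right
          by_cases hyK : y ∈ K
          · exact Or.inr ⟨y, Or.inr hyK, rfl, by rw [hgK y hyK, hd0 y hyK, hφ1 hyK]; simp⟩
          · by_cases hyA : y ∈ A
            · exact Or.inr ⟨y, Or.inl (subset_closure hyA), rfl, (hgA y hyA).symm⟩
            · exact Or.inl ⟨y, hyA, rfl, (hgd y hyA hyK).symm⟩
      · rintro (⟨y, rfl, rfl⟩ | ⟨y, hy, rfl, rfl⟩ | ⟨y, hy, rfl, rfl⟩)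
        · exact Or.inl rfl
        · by_cases hyK : y ∈ K
          · exact Or.inl (hd0 y hyK)
          · exact Or.inr (hgd y hy hyK).symm
        · right
          by_cases hyK : y ∈ K
          · rw [hgK y hyK, hd0 y hyK, hφ1 hyK]
            simp
          · by_cases hyA : y ∈ A
            · exact (hgA y hyA).symm
            · rw [hgd y hyA hyK, hφA y (hy.resolve_right hyK) hyA hyK, add_zero]
    rw [this]
    exact (isCompact_range (by fun_prop)).union <|
      (hAo.isClosed_compl.isCompact.image (by fun_prop)).union <|
        (isClosed_closure.union hKc).isCompact.image (by fun_prop)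
  refine isMToOneRetract_two_of_graph g hgpos hcomp ?_
  let G : Set (Y × ℝ) := (fun y => (y, g y)) '' Kᶜ
  have hGS : closure G ⊆ {p : Y × ℝ | p.2 = 0 ∨ p.2 = g p.1} := by
    refine closure_minimal ?_ hcomp.isClosed
    rintro _ ⟨y, -, rfl⟩
    exact Or.inr rfl
  have hG : IsConnected (closure G) :=
    (hconn.image _ (continuousOn_id.prodMk hgcont)).closure
  have hdec : {p : Y × ℝ | p.2 = 0 ∨ p.2 = g p.1} =
      (range (fun y : Y => (y, (0 : ℝ))) ∪ closure G) ∪ (fun y => (y, (1 : ℝ))) '' K := by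
    apply Subset.antisymm
    · rintro ⟨y, t⟩ (h | h)
      · exact Or.inl (Or.inl ⟨y, Prod.ext rfl h.symm⟩)
      · by_cases hyK : y ∈ K
        · exact Or.inr ⟨y, hyK, Prod.ext rfl ((hgK y hyK).symm.trans h.symm)⟩
        · exact Or.inl (Or.inr (subset_closure ⟨y, hyK, Prod.ext rfl h.symm⟩))
    · rintro _ ((⟨y, rfl⟩ | h) | ⟨y, hy, rfl⟩)
      · exact Or.inl rfl
      · exact hGS h
      · exact Or.inr (hgK y hy).symm
  obtain ⟨a, haK, ha⟩ := hlimA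
  obtain ⟨b, hbK, hb⟩ := hlimB
  have haG : (a, (1 : ℝ)) ∈ closure G := by
    have h : Continuous fun y => (y, d y + φ y) := by fun_prop
    have := map_mem_closure h ha (t := G) fun y hy =>
      ⟨y, hAK y hy, Prod.ext rfl (hgA y hy)⟩
    simpa [hd0 a haK, hφ1 haK] using this
  have hbG : (b, (0 : ℝ)) ∈ closure G := by
    have h : Continuous fun y => (y, d y) := by fun_prop
    have := map_mem_closure h hb (t := G) fun y hy =>
      ⟨y, hBK y hy, Prod.ext rfl (hgd y (hBA y hy) (hBK y hy))⟩
    simpa [hd0 b hbK] using this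
  rw [hdec]
  have h0 : IsConnected (range fun y : Y => (y, (0 : ℝ))) := isConnected_range (by fun_prop)
  have h1 : IsConnected ((fun y => (y, (1 : ℝ))) '' K) := hK.2.image _ (by fun_prop)
  exact .union ⟨(a, 1), Or.inr haG, a, haK, rfl⟩ (.union ⟨(b, 0), ⟨b, rfl⟩, hbG⟩ h0 hG) h1
end

section
/- If f is a strictly locally 1-to-1 continuous map from a continuum X into a continuum Y with f(X) = Y, and there is a closed subset A of X such that f is injective on A and f is injective on X \ A, then Y is a 2-to-1 retract of a continuum. -/
open Set Metric Topology

/-- The pairs of distinct points identified by a continuous locally injective map form a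
closed set. -/
theorem isClosed_setOf_ne_and_eq {X Y : Type*} [TopologicalSpace X] [TopologicalSpace Y]
    [T2Space Y] {f : X → Y} (hf : Continuous f) (hloc : ∀ x, ∃ U ∈ 𝓝 x, Set.InjOn f U) :
    IsClosed {z : X × X | z.1 ≠ z.2 ∧ f z.1 = f z.2} := by
  rw [← isOpen_compl_iff, isOpen_iff_mem_nhds]
  rintro ⟨a, b⟩ hab
  by_cases hfab : f a = f b
  · have heq : a = b := by
      by_contra hne
      exact hab ⟨hne, hfab⟩
    subst heq
    obtain ⟨U, hU, hinj⟩ := hloc a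
    filter_upwards [prod_mem_nhds hU hU] with z hz hz'
    exact hz'.1 (hinj hz.1 hz.2 hz'.2)
  · have hopen : IsOpen {z : X × X | f z.1 ≠ f z.2} :=
      isOpen_ne_fun (hf.comp continuous_fst) (hf.comp continuous_snd)
    filter_upwards [hopen.mem_nhds hfab] with z hz hz'
    exact hz hz'.2

/-- If every fibre of `f` meets the complement of a nonempty closed set `P` in exactly one
point, then attaching the domain of `f` to its codomain along `f` restricted to `P` exhibits
the codomain as a 2-to-1 retract. The resulting space is realised in `Y × ℝ` by using the
distance to `P` as second coordinate. -/
theorem isMToOneRetract_two_of_existsUnique_notMem {X Y : Type} [MetricSpace X] [CompactSpace X]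
    [ConnectedSpace X] [MetricSpace Y] [CompactSpace Y] [ConnectedSpace Y] {f : X → Y}
    (hf : Continuous f) {P : Set X} (hP : IsClosed P) (hPne : P.Nonempty)
    (hfib : ∀ y, ∃! x, f x = y ∧ x ∉ P) : IsMToOneRetract 2 Y := by
  let g : X → Y × ℝ := fun x => (f x, infDist x P)
  let i : Y → Y × ℝ := fun y => (y, 0)
  have hg : Continuous g := hf.prodMk (continuous_infDist_pt P)
  have hi : Continuous i := continuous_id.prodMk continuous_const
  have hzero : ∀ x, infDist x P = 0 ↔ x ∈ P := fun x => (hP.mem_iff_infDist_zero hPne).symm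
  obtain ⟨p, hp⟩ := hPne
  let Z : Set (Y × ℝ) := range g ∪ range i
  have hiZ : ∀ y, i y ∈ Z := fun y => Or.inr ⟨y, rfl⟩
  have hZcomp : IsCompact Z := (isCompact_range hg).union (isCompact_range hi)
  have hZconn : IsConnected Z :=
    (isConnected_range hg).union
      ⟨g p, ⟨p, rfl⟩, f p, Prod.ext rfl ((hzero p).2 hp).symm⟩ (isConnected_range hi)
  let j : Y → Z := fun y => ⟨i y, hiZ y⟩
  have hj : Continuous j := hi.subtype_mk hiZ
  have hemb : IsEmbedding j :=
    (hj.isClosedEmbedding fun a b h => congrArg (fun z : Z => z.1.1) h).isEmbedding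
  refine ⟨Z, inferInstance, isCompact_iff_compactSpace.1 hZcomp,
    isConnected_iff_connectedSpace.1 hZconn, hZconn.nonempty.to_subtype, range j,
    ⟨isCompact_range hj, isConnected_range hj⟩, ⟨hemb.toHomeomorph⟩,
    fun z => j z.1.1, hj.comp (continuous_fst.comp continuous_subtype_val),
    fun z => ⟨_, rfl⟩, ?_, ?_⟩
  · rintro _ ⟨y, rfl⟩
    rfl
  · rintro _ ⟨y, rfl⟩
    obtain ⟨x, ⟨hxy, hxP⟩, hx⟩ := hfib y
    have hfibre : {z : Z | j z.1.1 = j y} = {j y, ⟨g x, Or.inl ⟨x, rfl⟩⟩} := by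
      ext z
      simp only [mem_ofPred_eq, mem_insert_iff, mem_singleton_iff, hemb.injective.eq_iff]
      constructor
      · intro hz
        obtain ⟨_, ⟨x', rfl⟩ | ⟨y', rfl⟩⟩ := z
        · by_cases hx'P : x' ∈ P
          · exact Or.inl (Subtype.ext (Prod.ext hz ((hzero x').2 hx'P)))
          · exact Or.inr (Subtype.ext (congrArg g (hx x' ⟨hz, hx'P⟩)))
        · exact Or.inl (Subtype.ext (congrArg i hz))
      · rintro (rfl | rfl)
        · rfl
        · exact hxy
    rw [hfibre]
    refine ncard_pair fun h => hxP ((hzero x).1 ?_)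
    exact (congrArg (fun z : Z => z.1.2) h).symm

/-- If `f` is a strictly locally 1-to-1 map from the continuum `X` onto the continuum `Y`
that is injective on a closed set `A` and injective on `X \ A`, then `Y` is a 2-to-1
retract of a continuum. -/
theorem strictlyLocallyInjective_injOn_closed_and_complement_implies_retract
    (X Y : Type) [MetricSpace X] [CompactSpace X] [ConnectedSpace X] [Nonempty X]
    [MetricSpace Y] [CompactSpace Y] [ConnectedSpace Y] [Nonempty Y]
    (f : X → Y) (hf : Continuous f) (hsurj : Function.Surjective f)
    (hsl : StrictlyLocallyInjective f)
    (A : Set X) (hA : IsClosed A) (hinjA : Set.InjOn f A) (hinjAc : Set.InjOn f Aᶜ) :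
    IsMToOneRetract 2 Y := by
  have hclosed := isClosed_setOf_ne_and_eq hf hsl.1
  have hP : IsClosed (A ∩ {x | ∃ x', x ≠ x' ∧ f x = f x'}) := by
    refine hA.inter ?_
    convert (hclosed.isCompact.image continuous_fst).isClosed using 1
    ext x
    simp
  refine isMToOneRetract_two_of_existsUnique_notMem hf hP ?_ fun y => ?_
  · obtain ⟨a, b, hab, hne⟩ : ∃ a b, f a = f b ∧ a ≠ b := by
      simpa [Function.Injective] using hsl.2
    by_cases ha : a ∈ A
    · exact ⟨a, ha, b, hne, hab⟩
    · by_cases hb : b ∈ A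
      · exact ⟨b, hb, a, hne.symm, hab.symm⟩
      · exact absurd (hinjAc ha hb hab) hne
  · refine existsUnique_of_exists_of_unique ?_ ?_
    · obtain ⟨x, rfl⟩ := hsurj y
      by_cases hx : x ∈ A ∩ {x | ∃ x', x ≠ x' ∧ f x = f x'}
      · obtain ⟨hxA, x', hne, hxx'⟩ := hx
        exact ⟨x', hxx'.symm, fun h => hne (hinjA hxA h.1 hxx')⟩
      · exact ⟨x, rfl, hx⟩
    · rintro a b ⟨rfl, ha⟩ ⟨hba, hb⟩
      by_contra hne
      by_cases haA : a ∈ A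
      · exact ha ⟨haA, b, hne, hba.symm⟩
      · by_cases hbA : b ∈ A
        · exact hb ⟨hbA, a, Ne.symm hne, hba⟩
        · exact hne (hinjAc haA hbA hba.symm)
end

section
/- If f is a strictly locally 1-to-1 continuous map from a decomposable continuum X into a continuum Y, and f is injective on each proper subcontinuum of X, then f(X) is a 2-to-1 retract of a continuum. -/
open Set Metric Topology

/-- The points at which a locally injective map from a compact space fails to be
injective form a closed set. -/
theorem isClosed_setOf_exists_ne_of_locallyInjective {X Y : Type*} [TopologicalSpace X]
    [CompactSpace X] [TopologicalSpace Y] [T2Space Y] {f : X → Y} (hf : Continuous f)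
    (hloc : ∀ x : X, ∃ U ∈ 𝓝 x, Set.InjOn f U) :
    IsClosed {x : X | ∃ x', x' ≠ x ∧ f x' = f x} := by
  choose U hU hUinj using hloc
  have hV : IsOpen (⋃ x, interior (U x) ×ˢ interior (U x)) :=
    isOpen_iUnion fun x => isOpen_interior.prod isOpen_interior
  have hS : IsClosed ({p : X × X | f p.1 = f p.2} ∩ (⋃ x, interior (U x) ×ˢ interior (U x))ᶜ) :=
    (isClosed_eq (by fun_prop) (by fun_prop)).inter hV.isClosed_compl
  convert isClosedMap_snd_of_compactSpace _ hS using 1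
  ext x
  constructor
  · rintro ⟨x', hne, hx'⟩
    refine ⟨(x', x), ⟨hx', fun hmem => hne ?_⟩, rfl⟩
    obtain ⟨z, hz⟩ := mem_iUnion.1 hmem
    exact hUinj z (interior_subset hz.1) (interior_subset hz.2) hx'
  · rintro ⟨⟨x', x⟩, ⟨hx', hnot⟩, rfl⟩
    refine ⟨x', fun h => hnot ?_, hx'⟩
    obtain rfl : x' = x := h
    have hx := mem_interior_iff_mem_nhds.2 (hU x')
    exact mem_iUnion.2 ⟨x', hx, hx⟩

/-- If a continuous map `f` on a continuum restricts to a bijection from the complement of a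
nonempty closed set `D` onto the image of `f`, then this image is a 2-to-1 retract. The ambient
continuum is obtained by attaching the domain to the image along `D`, and is realized in `Y × ℝ`
by using the distance to `D` as the second coordinate. -/
theorem isMToOneRetract_two_range_of_bijOn_compl {X Y : Type} [MetricSpace X] [CompactSpace X]
    [ConnectedSpace X] [MetricSpace Y] {f : X → Y} (hf : Continuous f) {D : Set X}
    (hD : IsClosed D) (hDne : D.Nonempty) (hbij : BijOn f Dᶜ (range f)) :
    IsMToOneRetract 2 (range f) := by
  let g : X → Y × ℝ := fun x => (f x, infDist x D)
  let i : X → Y × ℝ := fun x => (f x, 0)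
  have hg : Continuous g := hf.prodMk (continuous_infDist_pt D)
  have hi : Continuous i := hf.prodMk continuous_const
  have hpos : ∀ x ∉ D, 0 < infDist x D := fun x hx => (hD.notMem_iff_infDist_pos hDne).1 hx
  have hgi : ∀ x ∈ D, g x = i x := fun x hx => by simp [g, i, infDist_zero_of_mem hx]
  let Z : Set (Y × ℝ) := range g ∪ range i
  have hZfst : ∀ z ∈ Z, z.1 ∈ range f := by
    rintro z (⟨x, rfl⟩ | ⟨x, rfl⟩) <;> exact ⟨x, rfl⟩
  have hZmem : ∀ y ∈ range f, (y, (0 : ℝ)) ∈ Z := by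
    rintro _ ⟨x, rfl⟩
    exact Or.inr ⟨x, rfl⟩
  have hZcomp : IsCompact Z := (isCompact_range hg).union (isCompact_range hi)
  have hZconn : IsConnected Z := by
    obtain ⟨d, hd⟩ := hDne
    exact (isConnected_range hg).union ⟨i d, ⟨d, hgi d hd⟩, ⟨d, rfl⟩⟩ (isConnected_range hi)
  let e : range f → Z := fun y => ⟨(y, 0), hZmem y y.2⟩
  have he : Continuous e := by fun_prop
  let p : Z → range f := fun z => ⟨z.1.1, hZfst z z.2⟩
  have hp : Continuous p := by fun_prop
  have hpe : Function.LeftInverse p e := fun y => rfl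
  have : CompactSpace (range f) := isCompact_iff_compactSpace.1 (isCompact_range hf)
  have : ConnectedSpace (range f) := Subtype.connectedSpace (isConnected_range hf)
  refine ⟨Z, inferInstance, isCompact_iff_compactSpace.1 hZcomp,
    Subtype.connectedSpace hZconn, hZconn.nonempty.to_subtype, range e,
    ⟨isCompact_range he, isConnected_range he⟩,
    ⟨(hpe.isEmbedding hp he).toHomeomorph⟩, e ∘ p, he.comp hp,
    fun z => ⟨p z, rfl⟩, ?_, ?_⟩
  · rintro _ ⟨y, rfl⟩
    rfl
  · rintro _ ⟨y, rfl⟩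
    obtain ⟨u, hu, huy⟩ := hbij.surjOn y.2
    rw [Set.ncard_eq_two]
    refine ⟨e y, ⟨g u, Or.inl ⟨u, rfl⟩⟩, fun h => ?_, ?_⟩
    · exact (hpos u hu).ne (congrArg (fun z : Z => z.1.2) h)
    · ext z
      simp only [Function.comp_apply, mem_ofPred_eq, hpe.injective.eq_iff, mem_insert_iff,
        mem_singleton_iff]
      constructor
      · rintro rfl
        obtain ⟨z, ⟨x, rfl⟩ | ⟨x, rfl⟩⟩ := z
        · by_cases hx : x ∈ D
          · exact Or.inl (Subtype.ext (hgi x hx))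
          · exact Or.inr (Subtype.ext (congrArg g (hbij.injOn hx hu huy.symm)))
        · exact Or.inl rfl
      · rintro (rfl | rfl)
        · rfl
        · exact Subtype.ext huy

/-- If `f` is a strictly locally 1-to-1 map from a decomposable continuum `X` into a
continuum `Y`, and `f` is injective on each proper subcontinuum of `X`, then `f(X)` is
a 2-to-1 retract of a continuum. -/
theorem image_of_decomposable_strictlyLocallyInjective_is_retract
    (X Y : Type) [MetricSpace X] [CompactSpace X] [ConnectedSpace X] [Nonempty X]
    [MetricSpace Y] [CompactSpace Y] [ConnectedSpace Y] [Nonempty Y]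
    (hdec : ∃ A B : Set X, IsSubcontinuum A ∧ A ≠ Set.univ ∧
      IsSubcontinuum B ∧ B ≠ Set.univ ∧ A ∪ B = Set.univ)
    (f : X → Y) (hf : Continuous f)
    (hsl : StrictlyLocallyInjective f) (hinj : InjOnProperSubcontinua f) :
    IsMToOneRetract 2 ↥(Set.range f) := by
  obtain ⟨A, B, hA, hAne, hB, hBne, hAB⟩ := hdec
  have hAinj := hinj A hA hAne
  have hBinj := hinj B hB hBne
  have hcover : ∀ x, x ∈ A ∨ x ∈ B := fun x => hAB.ge (mem_univ x)
  obtain ⟨hloc, hninj⟩ := hsl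
  have hinjOn : InjOn f (A ∩ {x : X | ∃ x', x' ≠ x ∧ f x' = f x})ᶜ := by
    intro x hx x' hx' h
    by_contra hne
    have hxA : x ∉ A := fun hxA => hx ⟨hxA, x', Ne.symm hne, h.symm⟩
    have hxA' : x' ∉ A := fun hxA' => hx' ⟨hxA', x, hne, h⟩
    exact hne (hBinj ((hcover x).resolve_left hxA) ((hcover x').resolve_left hxA') h)
  refine isMToOneRetract_two_range_of_bijOn_compl hf
    (hA.1.isClosed.inter (isClosed_setOf_exists_ne_of_locallyInjective hf hloc)) ?_
    ⟨fun x _ => mem_range_self x, hinjOn, ?_⟩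
  · by_contra hempty
    rw [not_nonempty_iff_eq_empty] at hempty
    rw [hempty, compl_empty, injOn_univ] at hinjOn
    exact hninj hinjOn
  · rintro _ ⟨x, rfl⟩
    by_cases hx : x ∈ A ∩ {x : X | ∃ x', x' ≠ x ∧ f x' = f x}
    · obtain ⟨hxA, x', hne, hx'⟩ := hx
      exact ⟨x', fun hmem => hne (hAinj hmem.1 hxA hx'), hx'⟩
    · exact ⟨x, hx, rfl⟩
end

section
/- If f is a strictly locally 1-to-1 continuous map from a hereditarily decomposable continuum X into a continuum Y, then f(X) is a 2-to-1 retract of a continuum. -/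
open Set Metric Topology

/-- The intersection of a directed family of subcontinua is connected. -/
theorem isSubcontinuum_sInter_of_directedOn {X : Type*} [TopologicalSpace X] [T2Space X]
    {c : Set (Set X)} (hne : c.Nonempty) (hdir : DirectedOn (· ⊇ ·) c)
    (hc : ∀ K ∈ c, IsSubcontinuum K) : IsSubcontinuum (⋂₀ c) := by
  have : Nonempty c := hne.to_subtype
  have hdir' : Directed (· ⊇ ·) (fun K : c => (K : Set X)) := hdir.directed_val
  obtain ⟨K₀, hK₀⟩ := hne
  have hclosed : IsClosed (⋂₀ c) := isClosed_sInter fun K hK => (hc K hK).1.isClosed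
  have hcomp : IsCompact (⋂₀ c) :=
    (hc K₀ hK₀).1.of_isClosed_subset hclosed (sInter_subset_of_mem hK₀)
  refine ⟨hcomp, ?_, ?_⟩
  · exact IsCompact.nonempty_sInter_of_directed_nonempty_isCompact_isClosed hdir
      (fun K hK => (hc K hK).2.nonempty) (fun K hK => (hc K hK).1)
      (fun K hK => (hc K hK).1.isClosed)
  · rw [isPreconnected_closed_iff]
    intro t t' ht ht' hsub hmt hmt'
    by_contra hemp
    rw [not_nonempty_iff_eq_empty] at hemp
    have hdisj : Disjoint (⋂₀ c ∩ t) (⋂₀ c ∩ t') := by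
      rw [disjoint_iff_inter_eq_empty, ← inter_inter_distrib_left]
      exact hemp
    obtain ⟨U, V, hU, hV, htU, htV, hUV⟩ :=
      SeparatedNhds.of_isCompact_isCompact (hcomp.inter_right ht) (hcomp.inter_right ht') hdisj
    obtain ⟨K, hK⟩ := exists_subset_nhds_of_isCompact (U := U ∪ V) hdir'
      (fun K => (hc K K.2).1) (fun x hx => (hU.union hV).mem_nhds (by
        rw [← sInter_eq_iInter] at hx
        exact (hsub hx).imp (fun h => htU ⟨hx, h⟩) (fun h => htV ⟨hx, h⟩)))
    obtain ⟨x, hx, hxt⟩ := hmt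
    obtain ⟨x', hx', hxt'⟩ := hmt'
    obtain ⟨z, -, hzU, hzV⟩ := (hc K K.2).2.isPreconnected U V hU hV hK
      ⟨x, hx K K.2, htU ⟨hx, hxt⟩⟩ ⟨x', hx' K K.2, htV ⟨hx', hxt'⟩⟩
    exact disjoint_left.1 hUV hzU hzV

/-- For a locally injective continuous map, the pairs of distinct points with equal images form
a closed set. -/
theorem isClosed_setOf_ne_and_eq_of_locallyInjective {X Y : Type*} [TopologicalSpace X]
    [TopologicalSpace Y] [T2Space Y] {f : X → Y} (hf : Continuous f)
    (hinj : ∀ x : X, ∃ U ∈ 𝓝 x, InjOn f U) :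
    IsClosed {p : X × X | p.1 ≠ p.2 ∧ f p.1 = f p.2} := by
  have hE : IsClosed {p : X × X | f p.1 = f p.2} :=
    isClosed_eq (hf.comp continuous_fst) (hf.comp continuous_snd)
  rw [← isOpen_compl_iff, isOpen_iff_mem_nhds]
  rintro ⟨x, x'⟩ hp
  by_cases hfx : f x = f x'
  · have hxx' : x = x' := by
      by_contra hne
      exact hp ⟨hne, hfx⟩
    subst hxx'
    obtain ⟨U, hU, hUinj⟩ := hinj x
    filter_upwards [prod_mem_nhds hU hU] with q hq hq'
    exact hq'.1 (hUinj hq.1 hq.2 hq'.2)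
  · filter_upwards [hE.isOpen_compl.mem_nhds hfx] with q hq hq'
    exact hq hq'.2

/-- A strictly locally injective map on a continuum has a minimal subcontinuum on which it is not
injective. -/
theorem StrictlyLocallyInjective.exists_minimal_not_injOn {X Y : Type*} [TopologicalSpace X]
    [T2Space X] [CompactSpace X] [ConnectedSpace X] [TopologicalSpace Y] [T2Space Y] {f : X → Y}
    (hf : Continuous f) (hsl : StrictlyLocallyInjective f) :
    ∃ K : Set X, Minimal (· ∈ {K | IsSubcontinuum K ∧ ¬ InjOn f K}) K := by
  have hD := isClosed_setOf_ne_and_eq_of_locallyInjective hf hsl.1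
  set D := {p : X × X | p.1 ≠ p.2 ∧ f p.1 = f p.2}
  suffices hchains : ∀ c ⊆ {K | IsSubcontinuum K ∧ ¬ InjOn f K}, IsChain (· ⊆ ·) c → c.Nonempty →
      ∃ lb ∈ {K | IsSubcontinuum K ∧ ¬ InjOn f K}, ∀ K ∈ c, lb ⊆ K by
    obtain ⟨K, -, hK⟩ := zorn_superset_nonempty _ hchains univ
      ⟨⟨isCompact_univ, isConnected_univ⟩, by rw [injOn_univ]; exact hsl.2⟩
    exact ⟨K, hK⟩
  intro c hcS hchain hne
  have hdir : DirectedOn (· ⊇ ·) c := fun A hA B hB =>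
    (hchain.total hA hB).elim (fun h => ⟨A, hA, Subset.rfl, h⟩) (fun h => ⟨B, hB, h, Subset.rfl⟩)
  refine ⟨⋂₀ c, ⟨isSubcontinuum_sInter_of_directedOn hne hdir fun K hK => (hcS hK).1, ?_⟩,
    fun K hK => sInter_subset_of_mem hK⟩
  have : Nonempty c := hne.to_subtype
  have hcomp : ∀ K : c, IsCompact (D ∩ (K : Set X) ×ˢ (K : Set X)) := fun K =>
    ((hcS K.2).1.1.prod (hcS K.2).1.1).inter_left hD
  obtain ⟨p, hp⟩ := IsCompact.nonempty_iInter_of_directed_nonempty_isCompact_isClosed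
    (fun K : c => D ∩ (K : Set X) ×ˢ (K : Set X))
    (hdir.directed_val.mono_comp (g := fun K : Set X => D ∩ K ×ˢ K) (· ⊇ ·)
      (fun _ _ h => inter_subset_inter_right _ (prod_mono h h)))
    (fun K => by
      have h := (hcS K.2).2
      simp only [InjOn, not_forall] at h
      obtain ⟨x, hx, x', hx', hfx, hne⟩ := h
      exact ⟨(x, x'), ⟨hne, hfx⟩, hx, hx'⟩)
    hcomp (fun K => (hcomp K).isClosed)
  rw [mem_iInter] at hp
  intro hinj
  have hpD : p ∈ D := (hp (Classical.arbitrary c)).1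
  exact hpD.1 (hinj (fun K hK => (hp ⟨K, hK⟩).2.1) (fun K hK => (hp ⟨K, hK⟩).2.2) hpD.2)

/-- A strictly locally injective map on a hereditarily decomposable continuum restricts to some
subcontinuum `K` so that, outside a nonempty closed subset `F` of `K`, it is injective and still
has image `f '' K`. -/
theorem HereditarilyDecomposable.exists_injOn_diff {X Y : Type*} [TopologicalSpace X]
    [T2Space X] [CompactSpace X] [ConnectedSpace X] [TopologicalSpace Y] [T2Space Y]
    (hher : HereditarilyDecomposable X) {f : X → Y}
    (hf : Continuous f) (hsl : StrictlyLocallyInjective f) :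
    ∃ K F : Set X, IsSubcontinuum K ∧ F ⊆ K ∧ F.Nonempty ∧ IsClosed F ∧ InjOn f (K \ F) ∧
      f '' (K \ F) = f '' K := by
  have hD := isClosed_setOf_ne_and_eq_of_locallyInjective hf hsl.1
  obtain ⟨K, ⟨hK, hKinj⟩, hKmin⟩ := hsl.exists_minimal_not_injOn hf
  have hpair : ∃ x ∈ K, ∃ x' ∈ K, f x = f x' ∧ x ≠ x' := by
    simpa only [InjOn, not_forall, exists_prop] using hKinj
  obtain ⟨x, hx, x', hx', hfx, hxx'⟩ := hpair
  obtain ⟨A, B, hA, hB, hAK, hBK, hAne, hBne, rfl⟩ := hher K hK ⟨x, hx, x', hx', hxx'⟩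
  have hinj : ∀ C, IsSubcontinuum C → C ⊆ A ∪ B → C ≠ A ∪ B → InjOn f C := by
    intro C hC hsub hne
    by_contra h
    exact hne (hsub.antisymm (hKmin ⟨hC, h⟩ hsub))
  have hAinj := hinj A hA hAK hAne
  have hBinj := hinj B hB hBK hBne
  refine ⟨A ∪ B, Prod.fst '' ({p : X × X | p.1 ≠ p.2 ∧ f p.1 = f p.2} ∩ A ×ˢ (A ∪ B)), hK,
    ?_, ?_, (((hA.1.prod hK.1).inter_left hD).image continuous_fst).isClosed, ?_, ?_⟩
  · rintro _ ⟨p, hp, rfl⟩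
    exact Or.inl hp.2.1
  · rcases hx with hxA | hxB
    · exact ⟨x, (x, x'), ⟨⟨hxx', hfx⟩, hxA, hx'⟩, rfl⟩
    · rcases hx' with hxA' | hxB'
      · exact ⟨x', (x', x), ⟨⟨hxx'.symm, hfx.symm⟩, hxA', Or.inr hxB⟩, rfl⟩
      · exact absurd (hBinj hxB hxB' hfx) hxx'
  · rintro y ⟨hy, hyF⟩ y' ⟨hy', hyF'⟩ hfy
    by_contra hne
    have hyA : y ∉ A := fun h => hyF ⟨(y, y'), ⟨⟨hne, hfy⟩, h, hy'⟩, rfl⟩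
    have hyA' : y' ∉ A := fun h => hyF' ⟨(y', y), ⟨⟨fun h => hne h.symm, hfy.symm⟩, h, hy⟩, rfl⟩
    exact hne (hBinj (hy.resolve_left hyA) (hy'.resolve_left hyA') hfy)
  · refine (image_mono sdiff_subset).antisymm ?_
    rintro _ ⟨y, hy, rfl⟩
    by_cases hyF : y ∈ Prod.fst '' ({p : X × X | p.1 ≠ p.2 ∧ f p.1 = f p.2} ∩ A ×ˢ (A ∪ B))
    · obtain ⟨⟨y, y'⟩, ⟨⟨hne, hfy⟩, hyA, hy'⟩, rfl⟩ := hyF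
      refine ⟨y', ⟨hy', ?_⟩, hfy.symm⟩
      rintro ⟨⟨z, z'⟩, ⟨-, hzA, -⟩, rfl⟩
      exact hne (hAinj hyA hzA hfy)
    · exact ⟨y, ⟨hy, hyF⟩, rfl⟩

/-- If `f` is injective on `K \ F` with `f '' (K \ F) = f '' K`, where `F` is a nonempty closed
subset of the subcontinuum `K`, then `range f` is a 2-to-1 retract: two copies of `range f` are
glued along `f '' K`, and `K` is attached to the first of them along `F`. -/
theorem isMToOneRetract_range_of_injOn_diff {X Y : Type} [MetricSpace X] [CompactSpace X]
    [ConnectedSpace X] [MetricSpace Y] {f : X → Y} (hf : Continuous f)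
    {K F : Set X} (hK : IsSubcontinuum K) (hFK : F ⊆ K) (hFne : F.Nonempty) (hF : IsClosed F)
    (hinj : InjOn f (K \ F)) (himg : f '' (K \ F) = f '' K) :
    IsMToOneRetract 2 ↥(range f) := by
  have hCcl : IsClosed (f '' K) := (hK.1.image hf).isClosed
  have hCne : (f '' K).Nonempty := hK.2.nonempty.image f
  obtain ⟨x₀, hx₀⟩ := id hFne
  have hcb : Continuous fun x => (f x, (0 : ℝ)) := by fun_prop
  have hcs : Continuous fun x => (f x, infDist (f x) (f '' K)) :=
    hf.prodMk ((continuous_infDist_pt _).comp hf)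
  have hca : Continuous fun x => (f x, -infDist x F) :=
    hf.prodMk (continuous_infDist_pt _).neg
  set base : Set (Y × ℝ) := range fun x => (f x, (0 : ℝ)) with hbase
  set sheet : Set (Y × ℝ) := range fun x => (f x, infDist (f x) (f '' K)) with hsheet
  set attached : Set (Y × ℝ) := (fun x => (f x, -infDist x F)) '' K with hattached
  set Z : Set (Y × ℝ) := base ∪ sheet ∪ attached with hZ
  have hmem₀ : ((f x₀, (0 : ℝ)) : Y × ℝ) ∈ base := ⟨x₀, rfl⟩
  have hZcompact : IsCompact Z :=
    ((isCompact_range hcb).union (isCompact_range hcs)).union (hK.1.image hca)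
  have hZconn : IsConnected Z := by
    refine IsConnected.union ⟨(f x₀, 0), Or.inl hmem₀, x₀, hFK hx₀, ?_⟩
      (IsConnected.union ⟨(f x₀, 0), hmem₀, x₀, ?_⟩ (isConnected_range hcb) (isConnected_range hcs))
      (hK.2.image _ hca.continuousOn)
    · simp [infDist_zero_of_mem hx₀]
    · simp [infDist_zero_of_mem (mem_image_of_mem f (hFK hx₀))]
  have hbaseZ : base ⊆ Z := fun z hz => Or.inl (Or.inl hz)
  have hZrange : ∀ z ∈ Z, z.1 ∈ range f := by
    rintro z ((⟨x, rfl⟩ | ⟨x, rfl⟩) | ⟨x, -, rfl⟩) <;> exact mem_range_self x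
  have hbase_iff : ∀ z : Y × ℝ, z ∈ base ↔ z.1 ∈ range f ∧ z.2 = 0 := by
    rintro ⟨y, t⟩
    constructor
    · rintro ⟨x, h⟩
      obtain ⟨rfl, rfl⟩ := Prod.mk.inj h
      exact ⟨mem_range_self x, rfl⟩
    · rintro ⟨⟨x, hx⟩, ht⟩
      exact ⟨x, Prod.ext hx ht.symm⟩
  have hfiber : ∀ y ∈ range f, ∃ t : ℝ, t ≠ 0 ∧ ∀ s : ℝ, (y, s) ∈ Z ↔ s = 0 ∨ s = t := by
    rintro y hy
    by_cases hyC : y ∈ f '' K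
    · obtain ⟨u, ⟨huK, huF⟩, rfl⟩ : y ∈ f '' (K \ F) := himg ▸ hyC
      refine ⟨-infDist u F, neg_ne_zero.2 ((hF.notMem_iff_infDist_pos hFne).1 huF).ne',
        fun s => ⟨?_, ?_⟩⟩
      · rintro ((⟨x, h⟩ | ⟨x, h⟩) | ⟨x, hxK, h⟩)
        · exact Or.inl (Prod.mk.inj h).2.symm
        · obtain ⟨h₁, h₂⟩ := Prod.mk.inj h
          left
          rw [← h₂, h₁, infDist_zero_of_mem hyC]
        · obtain ⟨h₁, h₂⟩ := Prod.mk.inj h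
          by_cases hxF : x ∈ F
          · left
            rw [← h₂, infDist_zero_of_mem hxF, neg_zero]
          · right
            rw [← h₂, hinj ⟨hxK, hxF⟩ ⟨huK, huF⟩ h₁]
      · rintro (rfl | rfl)
        · exact hbaseZ ((hbase_iff _).2 ⟨hy, rfl⟩)
        · exact Or.inr ⟨u, huK, rfl⟩
    · refine ⟨infDist y (f '' K), ((hCcl.notMem_iff_infDist_pos hCne).1 hyC).ne',
        fun s => ⟨?_, ?_⟩⟩
      · rintro ((⟨x, h⟩ | ⟨x, h⟩) | ⟨x, hxK, h⟩)
        · exact Or.inl (Prod.mk.inj h).2.symm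
        · obtain ⟨rfl, rfl⟩ := Prod.mk.inj h
          exact Or.inr rfl
        · exact absurd ⟨x, hxK, (Prod.mk.inj h).1⟩ hyC
      · rintro (rfl | rfl)
        · exact hbaseZ ((hbase_iff _).2 ⟨hy, rfl⟩)
        · obtain ⟨x, rfl⟩ := hy
          exact Or.inl (Or.inr ⟨x, rfl⟩)
  let r : Z → Z := fun z => ⟨(z.1.1, 0), hbaseZ ((hbase_iff _).2 ⟨hZrange z.1 z.2, rfl⟩)⟩
  have hr : Continuous r := by
    refine Continuous.subtype_mk ?_ _
    fun_prop
  let e : range f ≃ₜ {z : Z | (z : Y × ℝ) ∈ base} :=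
    { toFun := fun y => ⟨⟨(y, 0), hbaseZ ((hbase_iff _).2 ⟨y.2, rfl⟩)⟩, (hbase_iff _).2 ⟨y.2, rfl⟩⟩
      invFun := fun z => ⟨z.1.1.1, hZrange _ z.1.2⟩
      left_inv := fun y => rfl
      right_inv := fun z => by
        ext1
        ext1
        exact Prod.ext rfl ((hbase_iff _).1 z.2).2.symm
      continuous_toFun := by fun_prop
      continuous_invFun := by fun_prop }
  have : CompactSpace (range f) := isCompact_iff_compactSpace.1 (isCompact_range hf)
  have : ConnectedSpace (range f) := isConnected_iff_connectedSpace.1 (isConnected_range hf)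
  refine ⟨Z, inferInstance, isCompact_iff_compactSpace.1 hZcompact,
    isConnected_iff_connectedSpace.1 hZconn, hZconn.nonempty.to_subtype,
    {z : Z | (z : Y × ℝ) ∈ base}, ⟨isCompact_iff_compactSpace.2 e.compactSpace,
      isConnected_iff_connectedSpace.2 (e.surjective.connectedSpace e.continuous)⟩, ⟨e⟩, r, hr,
    fun z => (hbase_iff _).2 ⟨hZrange z.1 z.2, rfl⟩, ?_, ?_⟩
  · intro z hz
    exact Subtype.ext (Prod.ext rfl ((hbase_iff _).1 hz).2.symm)
  · rintro ⟨⟨y, s⟩, hz⟩ hzb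
    obtain ⟨hy, rfl⟩ : y ∈ range f ∧ s = 0 := (hbase_iff _).1 hzb
    obtain ⟨t, ht, hiff⟩ := hfiber y hy
    rw [ncard_eq_two]
    refine ⟨⟨(y, 0), hz⟩, ⟨(y, t), (hiff t).2 (Or.inr rfl)⟩, ?_, ?_⟩
    · intro h
      exact ht (Prod.mk.inj (Subtype.mk.inj h)).2.symm
    · ext ⟨⟨y', s⟩, hz'⟩
      simp only [mem_ofPred_eq, mem_insert_iff, mem_singleton_iff, r, Subtype.mk.injEq,
        Prod.mk.injEq, and_true]
      constructor
      · rintro rfl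
        exact ((hiff s).1 hz').imp (fun h => ⟨rfl, h⟩) (fun h => ⟨rfl, h⟩)
      · rintro (h | h) <;> exact h.1

/-- If `f` is a strictly locally 1-to-1 map from a hereditarily decomposable continuum `X`
into a continuum `Y`, then `f(X)` is a 2-to-1 retract of a continuum. -/
theorem image_of_hereditarilyDecomposable_strictlyLocallyInjective_is_retract
    (X Y : Type) [MetricSpace X] [CompactSpace X] [ConnectedSpace X] [Nonempty X]
    [MetricSpace Y] [CompactSpace Y] [ConnectedSpace Y] [Nonempty Y]
    (hher : HereditarilyDecomposable X)
    (f : X → Y) (hf : Continuous f) (hsl : StrictlyLocallyInjective f) :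
    IsMToOneRetract 2 ↥(Set.range f) := by
  obtain ⟨K, F, hK, hFK, hFne, hF, hinj, himg⟩ := hher.exists_injOn_diff hf hsl
  exact isMToOneRetract_range_of_injOn_diff hf hK hFK hFne hF hinj himg
end

section
/- If f is a strictly locally 1-to-1 continuous map defined on a continuum X that is a finite union of subcontinua each of which is either arclike or hereditarily decomposable, then f(X) is a 2-to-1 retract of a continuum. -/
open Set Metric Topology

/-- Suppose that removing a closed set `D` meeting a continuum `M` leaves a set on which `f` is
injective with the same image as on `M`. Then every continuum containing that image is a 2-to-1
retract: over `f '' M` the second sheet is `M \ D`, elsewhere it is a copy of `Y`. -/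
theorem isMToOneRetract_two_of_injOn_diff {X Y : Type} [MetricSpace X] [MetricSpace Y]
    [CompactSpace Y] [ConnectedSpace Y] {f : X → Y} (hf : Continuous f) {M D : Set X}
    (hM : IsSubcontinuum M) (hD : IsClosed D) (hMD : (M ∩ D).Nonempty)
    (hinj : InjOn f (M \ D)) (hsurj : ∀ x ∈ M, ∃ x' ∈ M \ D, f x' = f x) :
    IsMToOneRetract 2 Y := by
  have hN : IsClosed (f '' M) := (hM.1.image hf).isClosed
  have hNne : (f '' M).Nonempty := hM.2.nonempty.image f
  obtain ⟨x₀, hx₀M, hx₀D⟩ := hMD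
  have hDne : D.Nonempty := ⟨x₀, hx₀D⟩
  have hc₀ : Continuous fun y : Y => (y, (0 : ℝ)) := by fun_prop
  have hc₁ : Continuous fun y : Y => (y, infDist y (f '' M)) :=
    continuous_id.prodMk (continuous_infDist_pt _)
  have hc₂ : Continuous fun x : X => (f x, infDist x D) :=
    hf.prodMk (continuous_infDist_pt _)
  set Z : Set (Y × ℝ) := (range (fun y : Y => (y, (0 : ℝ))) ∪
    range (fun y : Y => (y, infDist y (f '' M)))) ∪
    (fun x : X => (f x, infDist x D)) '' M
  have hZcompact : IsCompact Z :=
    ((isCompact_range hc₀).union (isCompact_range hc₁)).union (hM.1.image hc₂)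
  have hZconn : IsConnected Z := by
    refine IsConnected.union ⟨(f x₀, 0), Or.inl ⟨f x₀, rfl⟩, ⟨x₀, hx₀M, ?_⟩⟩
      (IsConnected.union ⟨(f x₀, 0), ⟨f x₀, rfl⟩, ⟨f x₀, ?_⟩⟩ (isConnected_range hc₀)
      (isConnected_range hc₁)) (hM.2.image _ hc₂.continuousOn)
    · simp [infDist_zero_of_mem hx₀D]
    · simp [infDist_zero_of_mem (mem_image_of_mem f hx₀M)]
  have hbase : ∀ y : Y, (y, (0 : ℝ)) ∈ Z := fun y => Or.inl (Or.inl ⟨y, rfl⟩)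
  have hsheet : ∀ y : Y, ∃ t : ℝ, t ≠ 0 ∧ (y, t) ∈ Z ∧ ∀ s, (y, s) ∈ Z → s = 0 ∨ s = t := by
    intro y
    by_cases hy : y ∈ f '' M
    · obtain ⟨x₁, hx₁, rfl⟩ := hy
      obtain ⟨x, hx, hxy⟩ := hsurj x₁ hx₁
      rw [← hxy]
      refine ⟨infDist x D, fun h => hx.2 ((hD.mem_iff_infDist_zero hDne).2 h),
        Or.inr ⟨x, hx.1, rfl⟩, ?_⟩
      rintro s ((⟨y, hy⟩ | ⟨y, hy⟩) | ⟨x', hx', hy⟩)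
      · exact Or.inl (congrArg Prod.snd hy).symm
      · simp only [Prod.mk.injEq] at hy
        left
        rw [← hy.2, hy.1]
        exact infDist_zero_of_mem (mem_image_of_mem f hx.1)
      · simp only [Prod.mk.injEq] at hy
        by_cases hx'D : x' ∈ D
        · left
          rw [← hy.2]
          exact infDist_zero_of_mem hx'D
        · right
          rw [← hy.2, hinj ⟨hx', hx'D⟩ hx hy.1]
    · refine ⟨infDist y (f '' M), fun h => hy ((hN.mem_iff_infDist_zero hNne).2 h),
        Or.inl (Or.inr ⟨y, rfl⟩), ?_⟩
      rintro s ((⟨y', hy'⟩ | ⟨y', hy'⟩) | ⟨x', hx', hy'⟩)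
      · exact Or.inl (congrArg Prod.snd hy').symm
      · simp only [Prod.mk.injEq] at hy'
        right
        rw [← hy'.2, hy'.1]
      · simp only [Prod.mk.injEq] at hy'
        exact absurd ⟨x', hx', hy'.1⟩ hy
  let ι : Y → Z := fun y => ⟨(y, 0), hbase y⟩
  have hι : Continuous ι := hc₀.subtype_mk _
  have hιemb : IsEmbedding ι := (hι.isClosedEmbedding fun a b h =>
    congrArg (fun z : Z => z.1.1) h).isEmbedding
  refine ⟨Z, inferInstance, isCompact_iff_compactSpace.1 hZcompact,
    isConnected_iff_connectedSpace.1 hZconn, hZconn.nonempty.to_subtype, range ι,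
    ⟨isCompact_range hι, isConnected_range hι⟩, ⟨hιemb.toHomeomorph⟩,
    fun z => ι z.1.1, hι.comp (continuous_fst.comp continuous_subtype_val),
    fun z => ⟨_, rfl⟩, ?_, ?_⟩
  · rintro _ ⟨y, rfl⟩
    rfl
  · rintro _ ⟨y, rfl⟩
    obtain ⟨t, ht, htZ, hall⟩ := hsheet y
    have : {z : Z | ι z.1.1 = ι y} = {ι y, ⟨(y, t), htZ⟩} := by
      ext ⟨⟨a, s⟩, has⟩
      simp only [mem_ofPred_eq, mem_insert_iff, mem_singleton_iff, ι, Subtype.mk.injEq,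
        Prod.mk.injEq, and_true]
      constructor
      · rintro rfl
        simpa using hall s has
      · rintro (h | h) <;> exact h.1
    rw [this, ncard_pair]
    intro h
    exact ht (congrArg (fun z : Z => z.1.2) h).symm

/-- A locally injective map on a compact metric space is injective at a uniform scale. -/
theorem exists_pos_forall_dist_lt_imp_eq {X Y : Type*} [MetricSpace X] [CompactSpace X]
    {f : X → Y} (h : ∀ x : X, ∃ U ∈ 𝓝 x, InjOn f U) :
    ∃ ε > (0 : ℝ), ∀ x y, f x = f y → dist x y < ε → x = y := by
  choose U hU hinj using h
  obtain ⟨ε, hε, hball⟩ := lebesgue_number_lemma_of_metric (s := (univ : Set X))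
    (c := fun x => interior (U x)) isCompact_univ (fun _ => isOpen_interior)
    fun x _ => mem_iUnion.2 ⟨x, mem_interior_iff_mem_nhds.2 (hU x)⟩
  refine ⟨ε, hε, fun x y hxy hd => ?_⟩
  obtain ⟨i, hi⟩ := hball x (mem_univ x)
  exact hinj i (interior_subset (hi (mem_ball_self hε)))
    (interior_subset (hi (by rwa [mem_ball, dist_comm]))) hxy

theorem isClosed_setOf_eq_and_le_dist {X Y : Type*} [MetricSpace X] [TopologicalSpace Y]
    [T2Space Y] {f : X → Y} (hf : Continuous f) (ε : ℝ) :
    IsClosed {p : X × X | f p.1 = f p.2 ∧ ε ≤ dist p.1 p.2} :=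
  (isClosed_eq (hf.comp continuous_fst) (hf.comp continuous_snd)).and
    (isClosed_le continuous_const continuous_dist)

theorem isMToOneRetract_two_of_union {X Y : Type} [MetricSpace X] [MetricSpace Y]
    [CompactSpace Y] [ConnectedSpace Y] {f : X → Y} (hf : Continuous f) {ε : ℝ} (hε : 0 < ε)
    (hsep : ∀ x y, f x = f y → dist x y < ε → x = y) {A B : Set X}
    (hA : IsSubcontinuum A) (hB : IsSubcontinuum B) (hAB : (A ∩ B).Nonempty)
    (hAinj : InjOn f A) (hBinj : InjOn f B) (hinj : ¬ InjOn f (A ∪ B)) :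
    IsMToOneRetract 2 Y := by
  set E : Set (X × X) := (A ×ˢ B) ∩ {p | f p.1 = f p.2 ∧ ε ≤ dist p.1 p.2}
  have hEcompact : IsCompact E :=
    (hA.1.prod hB.1).inter_right (isClosed_setOf_eq_and_le_dist hf ε)
  have hmem : ∀ x ∈ A, ∀ y ∈ B, f x = f y → x ≠ y → x ∈ Prod.fst '' E :=
    fun x hx y hy hxy hne =>
      ⟨(x, y), ⟨⟨hx, hy⟩, hxy, not_lt.1 fun h => hne (hsep x y hxy h)⟩, rfl⟩
  have hnot : ∀ p ∈ E, p.2 ∉ A ∧ p.1 ≠ p.2 := by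
    rintro ⟨x, y⟩ ⟨⟨hx, -⟩, hxy, hd⟩
    have hne : x ≠ y := by
      rintro rfl
      simp only [dist_self] at hd
      linarith
    exact ⟨fun hy => hne (hAinj hx hy hxy), hne⟩
  refine isMToOneRetract_two_of_injOn_diff hf (M := A ∪ B) (D := Prod.fst '' E)
    ⟨hA.1.union hB.1, hA.2.union hAB hB.2⟩ (hEcompact.image continuous_fst).isClosed ?_ ?_ ?_
  · simp only [InjOn, not_forall] at hinj
    obtain ⟨x, hx, y, hy, hxy, hne⟩ := hinj
    rcases hx with hx | hx <;> rcases hy with hy | hy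
    · exact absurd (hAinj hx hy hxy) hne
    · exact ⟨x, Or.inl hx, hmem x hx y hy hxy hne⟩
    · exact ⟨y, Or.inl hy, hmem y hy x hx hxy.symm (Ne.symm hne)⟩
    · exact absurd (hBinj hx hy hxy) hne
  · rintro x ⟨hx | hx, hxE⟩ y ⟨hy | hy, hyE⟩ hxy
    · exact hAinj hx hy hxy
    · exact by_contra fun hne => hxE (hmem x hx y hy hxy hne)
    · exact by_contra fun hne => hyE (hmem y hy x hx hxy.symm (Ne.symm hne))
    · exact hBinj hx hy hxy
  · intro x hx
    by_cases hxE : x ∈ Prod.fst '' E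
    · obtain ⟨⟨x, y⟩, hp, rfl⟩ := hxE
      refine ⟨y, ⟨Or.inr hp.1.2, ?_⟩, hp.2.1.symm⟩
      rintro ⟨q, hq, rfl⟩
      exact (hnot _ hp).1 hq.1.1
    · exact ⟨x, ⟨hx, hxE⟩, rfl⟩

/-- A map `g` fine enough to separate the points of each fibre of `f` selects one point in each
fibre of `f`, namely the one with the largest value of `g`. -/
theorem isMToOneRetract_two_of_arclike {X Y : Type} [MetricSpace X] [CompactSpace X]
    [ConnectedSpace X] [MetricSpace Y] [CompactSpace Y] [ConnectedSpace Y] (hX : Arclike X)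
    {f : X → Y} (hf : Continuous f) {ε : ℝ} (hε : 0 < ε)
    (hsep : ∀ x y, f x = f y → dist x y < ε → x = y) (hinj : ¬ Function.Injective f) :
    IsMToOneRetract 2 Y := by
  obtain ⟨g, hg, -, hdiam⟩ := hX ε hε
  have hg_dist : ∀ x y, g x = g y → dist x y < ε := fun x y hxy =>
    (dist_le_diam_of_mem ((isClosed_singleton.preimage hg).isCompact.isBounded)
      (show x ∈ g ⁻¹' {g y} from hxy) rfl).trans_lt (hdiam (g y))
  set E : Set (X × X) := {p | f p.1 = f p.2 ∧ ε ≤ dist p.1 p.2} ∩ {p | g p.1 ≤ g p.2}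
  have hEcompact : IsCompact E :=
    ((isClosed_setOf_eq_and_le_dist hf ε).inter
      (isClosed_le (hg.comp continuous_fst) (hg.comp continuous_snd))).isCompact
  have hmem : ∀ x y, f x = f y → x ≠ y → g x ≤ g y → x ∈ Prod.fst '' E :=
    fun x y hxy hne hle =>
      ⟨(x, y), ⟨⟨hxy, not_lt.1 fun h => hne (hsep x y hxy h)⟩, hle⟩, rfl⟩
  refine isMToOneRetract_two_of_injOn_diff hf (M := univ) (D := Prod.fst '' E)
    ⟨isCompact_univ, isConnected_univ⟩ (hEcompact.image continuous_fst).isClosed ?_ ?_ ?_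
  · simp only [Function.Injective, not_forall] at hinj
    obtain ⟨x, y, hxy, hne⟩ := hinj
    rcases le_total (g x) (g y) with h | h
    · exact ⟨x, mem_univ x, hmem x y hxy hne h⟩
    · exact ⟨y, mem_univ y, hmem y x hxy.symm (Ne.symm hne) h⟩
  · rintro x ⟨-, hx⟩ y ⟨-, hy⟩ hxy
    by_contra hne
    rcases le_total (g x) (g y) with h | h
    · exact hx (hmem x y hxy hne h)
    · exact hy (hmem y x hxy.symm (Ne.symm hne) h)
  · intro x _
    obtain ⟨p, hp, hmax⟩ := (isClosed_singleton.preimage hf).isCompact.exists_isMaxOn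
      (show (f ⁻¹' {f x}).Nonempty from ⟨x, rfl⟩) hg.continuousOn
    refine ⟨p, ⟨mem_univ p, ?_⟩, hp⟩
    rintro ⟨⟨p, q⟩, ⟨⟨hpq, hd⟩, hle⟩, rfl⟩
    have hq : g q ≤ g p := hmax (show f q = f x from hpq.symm.trans hp)
    exact (hg_dist p q (le_antisymm hle hq)).not_ge hd

theorem IsChain.directedOn_superset {X : Type*} {c : Set (Set X)} (h : IsChain (· ⊆ ·) c) :
    DirectedOn (· ⊇ ·) c := fun A hA B hB =>
  (h.total hA hB).elim (fun hAB => ⟨A, hA, subset_rfl, hAB⟩) fun hBA => ⟨B, hB, hBA, subset_rfl⟩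

/-- The intersection of a chain of subcontinua is a subcontinuum. -/
theorem IsSubcontinuum.sInter_of_isChain {X : Type*} [TopologicalSpace X] [CompactSpace X]
    [T2Space X] {c : Set (Set X)} (hc : ∀ K ∈ c, IsSubcontinuum K) (hchain : IsChain (· ⊆ ·) c)
    (hne : c.Nonempty) : IsSubcontinuum (⋂₀ c) := by
  have : Nonempty c := hne.to_subtype
  have hdir : DirectedOn (· ⊇ ·) c := hchain.directedOn_superset
  have hclosed : IsClosed (⋂₀ c) := isClosed_sInter fun K hK => (hc K hK).1.isClosed
  refine ⟨hclosed.isCompact, IsCompact.nonempty_sInter_of_directed_nonempty_isCompact_isClosed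
    hdir (fun K hK => (hc K hK).2.nonempty) (fun K hK => (hc K hK).1)
    fun K hK => (hc K hK).1.isClosed, ?_⟩
  rw [isPreconnected_iff_subset_of_fully_disjoint_closed hclosed]
  intro u v hu hv hsub huv
  obtain ⟨U, V, hU, hV, huU, hvV, hUV⟩ := normal_separation hu hv huv
  obtain ⟨⟨K, hK⟩, hKUV⟩ := exists_subset_nhds_of_isCompact (V := fun K : c => K.1)
    (DirectedOn.directed_val hdir) (fun K => (hc K.1 K.2).1) (U := U ∪ V) fun x hx =>
      (hU.union hV).mem_nhds <| by
        rw [← sInter_eq_iInter] at hx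
        exact (hsub hx).imp (fun h => huU h) fun h => hvV h
  have hcK : ⋂₀ c ⊆ K := sInter_subset_of_mem hK
  rcases (hc K hK).2.isPreconnected.subset_or_subset hU hV hUV hKUV with h | h
  · left
    intro x hx
    exact (hsub hx).resolve_right fun hxv => disjoint_left.1 hUV (h (hcK hx)) (hvV hxv)
  · right
    intro x hx
    exact (hsub hx).resolve_left fun hxu => disjoint_left.1 hUV (huU hxu) (h (hcK hx))

/-- There is a minimal subcontinuum on which `f` is not injective. -/
theorem exists_minimal_subcontinuum_not_injOn {X Y : Type*} [MetricSpace X] [CompactSpace X]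
    [ConnectedSpace X] [TopologicalSpace Y] [T2Space Y] {f : X → Y} (hf : Continuous f) {ε : ℝ}
    (hε : 0 < ε) (hsep : ∀ x y, f x = f y → dist x y < ε → x = y)
    (hinj : ¬ Function.Injective f) :
    ∃ M : Set X, Minimal (fun K => IsSubcontinuum K ∧ ¬ InjOn f K) M := by
  have hiff : ∀ K : Set X, ¬ InjOn f K ↔
      ((K ×ˢ K) ∩ {p : X × X | f p.1 = f p.2 ∧ ε ≤ dist p.1 p.2}).Nonempty := by
    intro K
    simp only [InjOn, not_forall]
    constructor
    · rintro ⟨x, hx, y, hy, hxy, hne⟩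
      exact ⟨(x, y), ⟨hx, hy⟩, hxy, not_lt.1 fun h => hne (hsep x y hxy h)⟩
    · rintro ⟨⟨x, y⟩, ⟨hx, hy⟩, hxy, hd⟩
      refine ⟨x, hx, y, hy, hxy, ?_⟩
      rintro rfl
      simp only [dist_self] at hd
      linarith
  have hclosed := isClosed_setOf_eq_and_le_dist hf ε
  refine (zorn_superset_nonempty {K : Set X | IsSubcontinuum K ∧ ¬ InjOn f K} ?_ univ
    ⟨⟨isCompact_univ, isConnected_univ⟩, by rwa [injOn_univ]⟩).imp fun _ h => h.2
  intro c hcS hchain hne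
  refine ⟨⋂₀ c, ⟨.sInter_of_isChain (fun K hK => (hcS hK).1) hchain hne, ?_⟩,
    fun K hK => sInter_subset_of_mem hK⟩
  have : Nonempty c := hne.to_subtype
  have hK : ∀ K : c, IsClosed ((K.1 ×ˢ K.1) ∩ {p : X × X | f p.1 = f p.2 ∧ ε ≤ dist p.1 p.2}) :=
    fun K => ((hcS K.2).1.1.isClosed.prod (hcS K.2).1.1.isClosed).inter hclosed
  obtain ⟨p, hp⟩ := IsCompact.nonempty_iInter_of_directed_nonempty_isCompact_isClosed
    (fun K : c => (K.1 ×ˢ K.1) ∩ {p : X × X | f p.1 = f p.2 ∧ ε ≤ dist p.1 p.2})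
    ((hchain.directedOn_superset).directed_val.mono_comp
      (g := fun K : Set X => (K ×ˢ K) ∩ {p : X × X | f p.1 = f p.2 ∧ ε ≤ dist p.1 p.2}) _
      fun _ _ h => inter_subset_inter_left _ (prod_mono h h))
    (fun K => (hiff K).1 (hcS K.2).2) (fun K => (hK K).isCompact) hK
  rw [mem_iInter] at hp
  obtain ⟨K₀⟩ := this
  exact (hiff _).2 ⟨p, ⟨fun K hK => (hp ⟨K, hK⟩).1.1, fun K hK => (hp ⟨K, hK⟩).1.2⟩, (hp K₀).2⟩

theorem isMToOneRetract_two_of_hereditarilyDecomposable {X Y : Type} [MetricSpace X]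
    [CompactSpace X] [ConnectedSpace X] [MetricSpace Y] [CompactSpace Y] [ConnectedSpace Y]
    (hX : HereditarilyDecomposable X) {f : X → Y} (hf : Continuous f) {ε : ℝ} (hε : 0 < ε)
    (hsep : ∀ x y, f x = f y → dist x y < ε → x = y) (hinj : ¬ Function.Injective f) :
    IsMToOneRetract 2 Y := by
  obtain ⟨M, ⟨hM, hMinj⟩, hmin⟩ := exists_minimal_subcontinuum_not_injOn hf hε hsep hinj
  have hMnt : M.Nontrivial := by
    by_contra h
    exact hMinj ((not_nontrivial_iff.1 h).injOn f)
  obtain ⟨A, B, hA, hB, hAM, hBM, hAne, hBne, rfl⟩ := hX M hM hMnt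
  have hinj_of : ∀ K, IsSubcontinuum K → K ⊆ A ∪ B → K ≠ A ∪ B → InjOn f K :=
    fun K hK hsub hne => by_contra fun h => hne (hsub.antisymm (hmin ⟨hK, h⟩ hsub))
  have hAB : (A ∩ B).Nonempty := by
    have := isPreconnected_closed_iff.1 hM.2.isPreconnected A B hA.1.isClosed hB.1.isClosed
      subset_rfl
      (hA.2.nonempty.mono (subset_inter hAM subset_rfl))
      (hB.2.nonempty.mono (subset_inter hBM subset_rfl))
    exact this.mono inter_subset_right
  exact isMToOneRetract_two_of_union hf hε hsep hA hB hAB (hinj_of A hA hAM hAne)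
    (hinj_of B hB hBM hBne) hMinj

/-- If a continuum is a finite union of subcontinua on each of which `f` is injective while `f`
itself is not, then some two subcontinua have the same property. -/
theorem exists_subcontinua_not_injOn_union {X Y : Type*} [TopologicalSpace X] [T2Space X]
    [ConnectedSpace X] {n : ℕ} {C : Fin n → Set X}
    (hC : ∀ i, IsSubcontinuum (C i)) (hcover : (⋃ i, C i) = univ) {f : X → Y}
    (hinj : ¬ Function.Injective f) (hCinj : ∀ i, InjOn f (C i)) :
    ∃ A B : Set X, IsSubcontinuum A ∧ IsSubcontinuum B ∧ (A ∩ B).Nonempty ∧ InjOn f A ∧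
      InjOn f B ∧ ¬ InjOn f (A ∪ B) := by
  classical
  obtain ⟨x⟩ : Nonempty X := inferInstance
  obtain ⟨i₀, -⟩ := mem_iUnion.1 (hcover.ge (mem_univ x))
  obtain ⟨S, hSmax⟩ := (Set.toFinite {S : Finset (Fin n) | IsSubcontinuum (⋃ i ∈ S, C i) ∧
    InjOn f (⋃ i ∈ S, C i)}).exists_maximal ⟨{i₀}, by simpa using ⟨hC i₀, hCinj i₀⟩⟩
  obtain ⟨hS, hSinj⟩ := hSmax.prop
  have hrest : ∃ i ∉ S, ((⋃ i ∈ S, C i) ∩ C i).Nonempty := by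
    by_contra! h
    have hclosed : IsClosed (⋃ i ∈ Sᶜ, C i) :=
      isClosed_biUnion_finset fun i _ => (hC i).1.isClosed
    have hdisj : Disjoint (⋃ i ∈ S, C i) (⋃ i ∈ Sᶜ, C i) := by
      rw [disjoint_iUnion₂_right]
      exact fun i hi => disjoint_iff_inter_eq_empty.2 (h i (Finset.mem_compl.1 hi))
    have hcompl : (⋃ i ∈ S, C i)ᶜ = ⋃ i ∈ Sᶜ, C i := by
      refine Subset.antisymm (fun y hy => ?_) (subset_compl_iff_disjoint_left.2 hdisj)
      obtain ⟨i, hi⟩ := mem_iUnion.1 (hcover.ge (mem_univ y))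
      exact mem_biUnion (Finset.mem_coe.2 (Finset.mem_compl.2 fun hiS =>
        hy (mem_biUnion (Finset.mem_coe.2 hiS) hi))) hi
    have hclopen : IsClopen (⋃ i ∈ S, C i) :=
      ⟨hS.1.isClosed, by rw [← isClosed_compl_iff, hcompl]; exact hclosed⟩
    rw [hclopen.eq_univ hS.2.nonempty, injOn_univ] at hSinj
    exact hinj hSinj
  obtain ⟨i, hiS, hi⟩ := hrest
  refine ⟨_, _, hS, hC i, hi, hSinj, hCinj i, fun h => hiS ?_⟩
  have heq : (⋃ j ∈ insert i S, C j) = (⋃ j ∈ S, C j) ∪ C i := by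
    rw [Finset.set_biUnion_insert, union_comm]
  refine hSmax.le_of_ge (y := insert i S) ?_ (Finset.subset_insert i S)
    (Finset.mem_insert_self i S)
  rw [mem_ofPred_eq, heq]
  exact ⟨⟨hS.1.union (hC i).1, hS.2.union hi (hC i).2⟩, h⟩

/-- If `f` is a strictly locally 1-to-1 map defined on a continuum `X` that is a finite
union of subcontinua each of which is arclike or hereditarily decomposable, then `f(X)`
is a 2-to-1 retract of a continuum. -/
theorem image_of_finite_union_arclike_or_hereditarilyDecomposable_is_retract
    (X Y : Type) [MetricSpace X] [CompactSpace X] [ConnectedSpace X] [Nonempty X]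
    [MetricSpace Y]
    (n : ℕ) (C : Fin n → Set X) (hC : ∀ i, IsSubcontinuum (C i))
    (hcover : (⋃ i, C i) = Set.univ)
    (halt : ∀ i, Arclike ↥(C i) ∨ HereditarilyDecomposable ↥(C i))
    (f : X → Y) (hf : Continuous f) (hsl : StrictlyLocallyInjective f) :
    IsMToOneRetract 2 ↥(Set.range f) := by
  obtain ⟨hloc, hinj⟩ := hsl
  have : CompactSpace (range f) := isCompact_iff_compactSpace.1 (isCompact_range hf)
  have : ConnectedSpace (range f) := isConnected_iff_connectedSpace.1 (isConnected_range hf)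
  obtain ⟨ε, hε, hsep⟩ := exists_pos_forall_dist_lt_imp_eq hloc
  set F : X → range f := rangeFactorization f
  have hF : Continuous F := hf.subtype_mk _
  have hFsep : ∀ x y, F x = F y → dist x y < ε → x = y :=
    fun x y hxy => hsep x y (congrArg Subtype.val hxy)
  have hFinj : ¬ Function.Injective F :=
    fun h => hinj (Subtype.val_injective.comp h)
  by_cases hCinj : ∀ i, InjOn F (C i)
  · obtain ⟨A, B, hA, hB, hAB, hAinj, hBinj, h⟩ :=
      exists_subcontinua_not_injOn_union hC hcover hFinj hCinj
    exact isMToOneRetract_two_of_union hF hε hFsep hA hB hAB hAinj hBinj h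
  · push Not at hCinj
    obtain ⟨i, hi⟩ := hCinj
    have : CompactSpace (C i) := isCompact_iff_compactSpace.1 (hC i).1
    have : ConnectedSpace (C i) := isConnected_iff_connectedSpace.1 (hC i).2
    have hFi : Continuous (F ∘ ((↑) : C i → X)) := hF.comp continuous_subtype_val
    have hi' : ¬ Function.Injective (F ∘ ((↑) : C i → X)) := by
      rwa [injOn_iff_injective] at hi
    have hsep' : ∀ x y : C i, (F ∘ (↑)) x = (F ∘ (↑)) y → dist x y < ε → x = y :=
      fun x y hxy hd => Subtype.ext (hFsep x y hxy hd)
    rcases halt i with h | h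
    · exact isMToOneRetract_two_of_arclike h hFi hε hsep' hi'
    · exact isMToOneRetract_two_of_hereditarilyDecomposable h hFi hε hsep' hi'
end
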